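/- arXiv:1612.05040 — 3 statements merged into one kernel-verified Lean document; each statement's English description precedes it below -/
import Mathlib

section
/- Let n ≥ 1, let 𝐗 ⊆ ℝ≥0^n be an interval and let C(𝐚) be an interval circulant matrix such that Â ∈ C(𝐚). Then for every x ∈ 𝐗 there exists A ∈ C(𝐚) with x ∈ Attr(A) (i.e., 𝐗 is tolerance C(𝐚)-robust) if and only if there exists A ∈ C(𝐚) such that x ∈ Attr(A) for every x ∈ 𝐗 (i.e., C(𝐚) is possibly 𝐗-robust). -/
open scoped NNReal Classical

namespace MaxAlg

variable {n : ℕ}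

/-- cyclic successor on `Fin k` -/
def cyc {k : ℕ} (l : Fin k) : Fin k := ⟨(l.val + 1) % k, Nat.mod_lt _ l.pos⟩

/-- max-algebraic matrix product -/
noncomputable def mmul (A B : Matrix (Fin n) (Fin n) ℝ≥0) : Matrix (Fin n) (Fin n) ℝ≥0 :=
  fun i k => Finset.univ.sup fun j => A i j * B j k

/-- max-algebraic identity matrix -/
def mId (n : ℕ) : Matrix (Fin n) (Fin n) ℝ≥0 := fun i j => if i = j then 1 else 0

/-- max-algebraic matrix power -/
noncomputable def mpow (A : Matrix (Fin n) (Fin n) ℝ≥0) : ℕ → Matrix (Fin n) (Fin n) ℝ≥0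
  | 0 => mId n
  | t + 1 => mmul (mpow A t) A

/-- max-algebraic matrix-vector product -/
noncomputable def mvec (A : Matrix (Fin n) (Fin n) ℝ≥0) (x : Fin n → ℝ≥0) : Fin n → ℝ≥0 :=
  fun i => Finset.univ.sup fun j => A i j * x j

/-- geometric mean of the cycle `c` of length `k` -/
noncomputable def cycMean (A : Matrix (Fin n) (Fin n) ℝ≥0) (k : ℕ) (c : Fin k → Fin n) : ℝ≥0 :=
  (∏ l : Fin k, A (c l) (c (cyc l))) ^ ((1 : ℝ) / (k : ℝ))

/-- maximum cycle geometric mean λ(A) -/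
noncomputable def lam (A : Matrix (Fin n) (Fin n) ℝ≥0) : ℝ≥0 :=
  (Finset.Icc 1 n).sup fun k => Finset.univ.sup fun c : Fin k → Fin n => cycMean A k c

/-- attraction cone Attr(A) -/
def Attr (A : Matrix (Fin n) (Fin n) ℝ≥0) : Set (Fin n → ℝ≥0) :=
  {x | ∃ s : ℕ, mvec (mpow A (s + 1)) x = fun i => lam A * mvec (mpow A s) x i}

/-- circulant matrix built from the vector of values `a_0, …, a_{n-1}` -/
def circ (a : Fin n → ℝ≥0) : Matrix (Fin n) (Fin n) ℝ≥0 := fun i j => a (j - i)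

/-- A is a circulant matrix -/
def IsCirculant (A : Matrix (Fin n) (Fin n) ℝ≥0) : Prop := ∃ a : Fin n → ℝ≥0, A = circ a

/-- (i,j) is a critical edge of A -/
def IsCritEdge (A : Matrix (Fin n) (Fin n) ℝ≥0) (i j : Fin n) : Prop :=
  A i j ≠ 0 ∧ ∃ (k : ℕ) (c : Fin k → Fin n), 1 ≤ k ∧
    (∀ l, A (c l) (c (cyc l)) ≠ 0) ∧
    cycMean A k c = lam A ∧ ∃ l, c l = i ∧ c (cyc l) = j

/-- there is a walk of length ≥ 1 from i to j in crit(A) -/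
def CritWalk (A : Matrix (Fin n) (Fin n) ℝ≥0) (i j : Fin n) : Prop :=
  ∃ l : ℕ, 1 ≤ l ∧ ∃ w : ℕ → Fin n, w 0 = i ∧ w l = j ∧
    ∀ r < l, IsCritEdge A (w r) (w (r + 1))

/-- node i lies on a critical cycle of A -/
def OnCritCycle (A : Matrix (Fin n) (Fin n) ℝ≥0) (i : Fin n) : Prop :=
  ∃ (k : ℕ) (c : Fin k → Fin n), 1 ≤ k ∧
    (∀ l, A (c l) (c (cyc l)) ≠ 0) ∧
    cycMean A k c = lam A ∧ ∃ l, c l = i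

/-- family of one-dimensional intervals with bounds `lo`, `hi`,
each of one of the four forms -/
def IsIntervalFam (S : Fin n → Set ℝ≥0) (lo hi : Fin n → ℝ≥0) : Prop :=
  ∀ i, (S i).Nonempty ∧
    (S i = Set.Icc (lo i) (hi i) ∨ S i = Set.Ico (lo i) (hi i) ∨
     S i = Set.Ioc (lo i) (hi i) ∨ S i = Set.Ioo (lo i) (hi i))

/-- the interval 𝐗 ⊆ ℝ≥0ⁿ determined by the family S -/
def box (S : Fin n → Set ℝ≥0) : Set (Fin n → ℝ≥0) := {x | ∀ i, x i ∈ S i}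

/-- vertex x^{(k)}: x̄ in coordinate k and x̲ elsewhere -/
def vtx (lo hi : Fin n → ℝ≥0) (k : Fin n) : Fin n → ℝ≥0 :=
  Function.update lo k (hi k)

/-- the interval circulant matrix C(𝐚) determined by the interval family Sa -/
def Cset (Sa : Fin n → Set ℝ≥0) : Set (Matrix (Fin n) (Fin n) ℝ≥0) :=
  {A | ∃ a : Fin n → ℝ≥0, (∀ k, a k ∈ Sa k) ∧ A = circ a}

/-- the matrix Â, with â_k = min(a̲, ā_k) where a̲ = max_k a̲_k -/
noncomputable def Ahat (alo ahi : Fin n → ℝ≥0) : Matrix (Fin n) (Fin n) ℝ≥0 :=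
  circ fun k => min (Finset.univ.sup alo) (ahi k)

/-- the matrix A^{(k)} = Circulant(a̲_0,…,a̲_{k−1}, ā_k, a̲_{k+1},…,a̲_{n−1}) -/
def Ak (alo ahi : Fin n → ℝ≥0) (k : Fin n) : Matrix (Fin n) (Fin n) ℝ≥0 :=
  circ (Function.update alo k (ahi k))

end MaxAlg

namespace MaxAlg

lemma mvec_mmul (A B : Matrix (Fin n) (Fin n) ℝ≥0) (x : Fin n → ℝ≥0) :
    mvec (mmul A B) x = mvec A (mvec B x) := by
  funext i
  simp only [mvec, mmul, NNReal.finset_sup_mul, NNReal.mul_finset_sup]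
  rw [Finset.sup_comm]
  simp only [mul_assoc]

lemma mvec_mId (x : Fin n → ℝ≥0) : mvec (mId n) x = x := by
  funext i
  refine le_antisymm (Finset.sup_le fun j _ => ?_) ?_
  · by_cases h : i = j <;> simp [mId, h]
  · have h := Finset.le_sup (f := fun j => mId n i j * x j) (Finset.mem_univ i)
    change x i ≤ Finset.univ.sup fun j => mId n i j * x j
    simpa [mId] using h

lemma mvec_mpow (A : Matrix (Fin n) (Fin n) ℝ≥0) (t : ℕ) (x : Fin n → ℝ≥0) :
    mvec (mpow A t) x = (mvec A)^[t] x := by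
  induction t generalizing x with
  | zero => exact mvec_mId x
  | succ t ih => rw [mpow, mvec_mmul, ih, Function.iterate_succ_apply]

lemma mem_Attr_iff (A : Matrix (Fin n) (Fin n) ℝ≥0) (x : Fin n → ℝ≥0) :
    x ∈ Attr A ↔ ∃ s : ℕ, (mvec A)^[s + 1] x = lam A • (mvec A)^[s] x := by
  simp only [Attr, Set.mem_ofPred_eq, mvec_mpow]
  rfl

lemma mvec_smul_right (A : Matrix (Fin n) (Fin n) ℝ≥0) (r : ℝ≥0) (x : Fin n → ℝ≥0) :
    mvec A (r • x) = r • mvec A x := by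
  funext i
  simp only [mvec, Pi.smul_apply, smul_eq_mul, NNReal.mul_finset_sup]
  exact Finset.sup_congr rfl fun j _ => mul_left_comm _ _ _

lemma mvec_circ_smul (r : ℝ≥0) (a x : Fin n → ℝ≥0) :
    mvec (circ (r • a)) x = r • mvec (circ a) x := by
  funext i
  simp only [mvec, circ, Pi.smul_apply, smul_eq_mul, NNReal.mul_finset_sup, mul_assoc]

lemma mvec_circ_smul_iterate (r : ℝ≥0) (a x : Fin n → ℝ≥0) (t : ℕ) :
    (mvec (circ (r • a)))^[t] x = r ^ t • (mvec (circ a))^[t] x := by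
  induction t with
  | zero => simp
  | succ t ih =>
    rw [Function.iterate_succ_apply', ih, mvec_smul_right, mvec_circ_smul,
      Function.iterate_succ_apply', smul_smul, pow_succ]

lemma mvec_circ_apply [NeZero n] (a x : Fin n → ℝ≥0) (i : Fin n) :
    mvec (circ a) x i = Finset.univ.sup fun g => a g * x (i + g) := by
  refine le_antisymm (Finset.sup_le fun j _ => ?_) (Finset.sup_le fun g _ => ?_)
  · have h := Finset.le_sup (f := fun g => a g * x (i + g)) (Finset.mem_univ (j - i))
    simpa [circ] using h
  · have h := Finset.le_sup (f := fun j => circ a i j * x j) (Finset.mem_univ (i + g))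
    change _ ≤ Finset.univ.sup fun j => circ a i j * x j
    simpa [circ] using h

lemma mul_le_mvec_circ [NeZero n] (a x : Fin n → ℝ≥0) (i g : Fin n) :
    a g * x (i + g) ≤ mvec (circ a) x i := by
  rw [mvec_circ_apply]
  exact Finset.le_sup (f := fun g => a g * x (i + g)) (Finset.mem_univ g)

lemma mvec_circ_mono {a b : Fin n → ℝ≥0} (h : a ≤ b) (x : Fin n → ℝ≥0) :
    mvec (circ a) x ≤ mvec (circ b) x :=
  fun _ => Finset.sup_mono_fun fun _ _ => mul_le_mul_left (h _) _

lemma mvec_circ_commute [NeZero n] (a b : Fin n → ℝ≥0) :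
    Function.Commute (mvec (circ a)) (mvec (circ b)) := by
  intro x
  funext i
  simp only [mvec_circ_apply, NNReal.mul_finset_sup]
  rw [Finset.sup_comm]
  refine Finset.sup_congr rfl fun g _ => Finset.sup_congr rfl fun h _ => ?_
  rw [mul_left_comm, add_right_comm]

lemma lam_circ [NeZero n] (a : Fin n → ℝ≥0) : lam (circ a) = Finset.univ.sup a := by
  refine le_antisymm (Finset.sup_le fun k hk => Finset.sup_le fun c _ => ?_) ?_
  · have hk0 : (k : ℝ) ≠ 0 := by
      have := (Finset.mem_Icc.1 hk).1
      positivity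
    calc cycMean (circ a) k c
        ≤ (∏ _l : Fin k, Finset.univ.sup a) ^ ((1 : ℝ) / k) :=
          NNReal.rpow_le_rpow
            (Finset.prod_le_prod' fun l _ =>
              Finset.le_sup (f := a) (Finset.mem_univ (c (cyc l) - c l))) (by positivity)
      _ = Finset.univ.sup a := by
          rw [Finset.prod_const, Finset.card_univ, Fintype.card_fin, ← NNReal.rpow_natCast,
            ← NNReal.rpow_mul, mul_one_div_cancel hk0, NNReal.rpow_one]
  · refine Finset.sup_le fun g _ => ?_
    have hn0 : (n : ℝ) ≠ 0 := by exact_mod_cast NeZero.ne n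
    let c : Fin n → Fin n := fun l => l.val • g
    have hng : n • g = 0 := by
      simpa using card_nsmul_eq_zero' (x := g)
    have hc : ∀ l, c (cyc l) - c l = g := by
      intro l
      have h1 : c (cyc l) = (l.val + 1) • g := by
        change ((l.val + 1) % n) • g = _
        conv_rhs => rw [← Nat.mod_add_div (l.val + 1) n, add_nsmul, mul_nsmul, hng]
        simp
      rw [h1, succ_nsmul]
      exact add_sub_cancel_left _ _
    have h1 : cycMean (circ a) n c = a g := by
      simp only [cycMean, circ, hc]
      rw [Finset.prod_const, Finset.card_univ, Fintype.card_fin, ← NNReal.rpow_natCast,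
        ← NNReal.rpow_mul, mul_one_div_cancel hn0, NNReal.rpow_one]
    rw [← h1]
    exact (Finset.le_sup (f := fun c : Fin n → Fin n => cycMean (circ a) n c)
      (Finset.mem_univ c)).trans
      (Finset.le_sup (f := fun k => Finset.univ.sup fun c : Fin k → Fin n => cycMean (circ a) k c)
        (Finset.mem_Icc.2 ⟨NeZero.one_le, le_rfl⟩))

lemma mem_Attr_circ_iff [NeZero n] {a : Fin n → ℝ≥0} (ha : Finset.univ.sup a ≠ 0)
    (x : Fin n → ℝ≥0) :
    x ∈ Attr (circ a) ↔ ∃ s : ℕ, (mvec (circ ((Finset.univ.sup a)⁻¹ • a)))^[s + 1] x =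
      (mvec (circ ((Finset.univ.sup a)⁻¹ • a)))^[s] x := by
  rw [mem_Attr_iff, lam_circ]
  generalize Finset.univ.sup a = m at ha
  refine exists_congr fun s => ?_
  have hr : m⁻¹ ^ (s + 1) ≠ 0 := pow_ne_zero _ (inv_ne_zero ha)
  rw [mvec_circ_smul_iterate, mvec_circ_smul_iterate, ← (smul_right_injective _ hr).eq_iff,
    smul_smul, pow_succ, mul_assoc, inv_mul_cancel₀ ha, mul_one]

/-- A monotone sequence whose values are monomials in numbers at most `1`, with coefficients from
a finite set, is eventually constant. -/
lemma eventually_const_of_monomial {ι κ : Type*} [Fintype ι] [Fintype κ] {b : ι → ℝ≥0}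
    (hb : b ≤ 1) (x : κ → ℝ≥0) {u : ℕ → ℝ≥0} (hu : Monotone u)
    (hval : ∀ t, ∃ (α : ι → ℕ) (l : κ), u t = (∏ g, b g ^ α g) * x l) :
    ∃ T, ∀ t, T ≤ t → u t = u T := by
  have hanti : ∀ l : κ, Monotone fun α : ι → ℕ =>
      OrderDual.toDual ((∏ g, b g ^ α g) * x l) := by
    intro l α β hαβ
    refine OrderDual.toDual_le_toDual.2 (mul_le_mul_left ?_ _)
    exact Finset.prod_le_prod' fun g _ => pow_le_pow_right_of_le_one' (hb g) (hαβ g)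
  have hpwo : (⋃ l ∈ (Finset.univ : Finset κ), (fun α : ι → ℕ =>
      OrderDual.toDual ((∏ g, b g ^ α g) * x l)) '' Set.univ).IsPWO :=
    (Finset.isPWO_bUnion _).2 fun l _ =>
      (Set.isPWO_univ_iff.2 inferInstance).image_of_monotone (hanti l)
  obtain ⟨φ, hφ⟩ := hpwo.exists_monotone_subseq (f := fun t => OrderDual.toDual (u t)) (by
    intro t
    obtain ⟨α, l, h⟩ := hval t
    exact Set.mem_biUnion (Finset.mem_univ l) ⟨α, trivial, by rw [h]⟩)
  refine ⟨φ 0, fun t ht => le_antisymm ?_ (hu ht)⟩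
  exact (hu φ.strictMono.le_apply).trans (hφ (Nat.zero_le t))

lemma iterate_mvec_circ_monomial [NeZero n] (b x : Fin n → ℝ≥0) (t : ℕ) (i : Fin n) :
    ∃ (α : Fin n → ℕ) (l : Fin n), (mvec (circ b))^[t] x i = (∏ g, b g ^ α g) * x l := by
  induction t generalizing i with
  | zero => exact ⟨0, i, by simp⟩
  | succ t ih =>
    rw [Function.iterate_succ_apply', mvec_circ_apply]
    obtain ⟨h, -, hh⟩ := Finset.exists_mem_eq_sup Finset.univ Finset.univ_nonempty
      fun g => b g * (mvec (circ b))^[t] x (i + g)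
    obtain ⟨α, l, hα⟩ := ih (i + h)
    refine ⟨α + Pi.single h 1, l, ?_⟩
    rw [hh, hα]
    simp only [Pi.add_apply, pow_add, Finset.prod_mul_distrib]
    have : ∏ g, b g ^ (Pi.single h 1 : Fin n → ℕ) g = b h := by
      rw [Finset.prod_eq_single h] <;> simp +contextual
    rw [this, mul_comm _ (b h), mul_assoc]

/-- The orbit of a vector under a normalized circulant matrix is ultimately a rotation. -/
lemma exists_iterate_mvec_circ_eq_rotation [NeZero n] {b : Fin n → ℝ≥0} (hb : b ≤ 1) {k : Fin n}
    (hk : b k = 1) (x : Fin n → ℝ≥0) :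
    ∃ T, ∀ t, T ≤ t → ∀ i, (mvec (circ b))^[t + 1] x i = (mvec (circ b))^[t] x (i + k) := by
  have hstep : ∀ i : Fin n, ∃ T, ∀ t, T ≤ t →
      (mvec (circ b))^[t] x (i - t • k) = (mvec (circ b))^[T] x (i - T • k) := by
    intro i
    refine eventually_const_of_monomial hb x (u := fun t => (mvec (circ b))^[t] x (i - t • k))
      (monotone_nat_of_le_succ fun t => ?_) fun t => iterate_mvec_circ_monomial b x t _
    have h := mul_le_mvec_circ b ((mvec (circ b))^[t] x) (i - (t + 1) • k) k
    rwa [hk, one_mul, ← Function.iterate_succ_apply' (mvec (circ b)), succ_nsmul,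
      sub_add_eq_sub_sub, sub_add_cancel, ← sub_add_eq_sub_sub, ← succ_nsmul] at h
  choose T hT using hstep
  refine ⟨Finset.univ.sup T, fun t ht i => ?_⟩
  have hi := hT (i + (t + 1) • k)
  have hle : T (i + (t + 1) • k) ≤ t := (Finset.le_sup (Finset.mem_univ _)).trans ht
  have h := (hi (t + 1) (hle.trans t.le_succ)).trans (hi t hle).symm
  rwa [add_sub_cancel_right, succ_nsmul', ← add_assoc, add_sub_cancel_right] at h

/-- Passing to a larger normalized circulant matrix enlarges the attraction cone. -/
lemma exists_iterate_fixed_of_le [NeZero n] {a b : Fin n → ℝ≥0} (hab : a ≤ b) (hb : b ≤ 1)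
    {k : Fin n} (hk : a k = 1) {x : Fin n → ℝ≥0}
    (hx : ∃ s : ℕ, (mvec (circ a))^[s + 1] x = (mvec (circ a))^[s] x) :
    ∃ s : ℕ, (mvec (circ b))^[s + 1] x = (mvec (circ b))^[s] x := by
  obtain ⟨s, hs⟩ := hx
  obtain ⟨T, hT⟩ :=
    exists_iterate_mvec_circ_eq_rotation hb (le_antisymm (hb k) (hk ▸ hab k)) x
  have hone : ∀ t, T ≤ t →
      mvec (circ a) ((mvec (circ b))^[t] x) = (mvec (circ b))^[t + 1] x := by
    intro t ht
    refine le_antisymm ?_ fun i => ?_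
    · rw [Function.iterate_succ_apply']
      exact mvec_circ_mono hab _
    · have h := mul_le_mvec_circ a ((mvec (circ b))^[t] x) i k
      rwa [hk, one_mul, ← hT t ht] at h
  have hmany : ∀ r, (mvec (circ a))^[r] ((mvec (circ b))^[T] x) = (mvec (circ b))^[T + r] x := by
    intro r
    induction r with
    | zero => rfl
    | succ r ih => rw [Function.iterate_succ_apply', ih, hone _ (Nat.le_add_right T r), add_assoc]
  have hcomm := fun r => ((mvec_circ_commute a b).iterate_iterate r T).eq x
  refine ⟨T + s, ?_⟩
  rw [add_assoc, ← hmany, ← hmany, hcomm, hcomm, hs]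

/-- If the entries of `a`, relative to their maximum, are dominated by those of `b`, then
the attraction cone of `circ a` is contained in that of `circ b`. -/
lemma Attr_circ_subset [NeZero n] {a b : Fin n → ℝ≥0} (ha : Finset.univ.sup a ≠ 0)
    (hb : Finset.univ.sup b ≠ 0)
    (hab : (Finset.univ.sup a)⁻¹ • a ≤ (Finset.univ.sup b)⁻¹ • b) :
    Attr (circ a) ⊆ Attr (circ b) := by
  intro x hx
  rw [mem_Attr_circ_iff hb]
  obtain ⟨k, -, hk⟩ := Finset.exists_mem_eq_sup Finset.univ Finset.univ_nonempty a
  refine exists_iterate_fixed_of_le hab (fun g => ?_) (k := k) ?_ ((mem_Attr_circ_iff ha x).1 hx)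
  · have hg : b g ≤ Finset.univ.sup b := Finset.le_sup (Finset.mem_univ g)
    calc (Finset.univ.sup b)⁻¹ * b g ≤ (Finset.univ.sup b)⁻¹ * Finset.univ.sup b := by gcongr
      _ = 1 := inv_mul_cancel₀ hb
  · rw [Pi.smul_apply, smul_eq_mul, ← hk, inv_mul_cancel₀ ha]

lemma mem_Attr_circ_of_sup_eq_zero [NeZero n] {a : Fin n → ℝ≥0} (ha : Finset.univ.sup a = 0)
    (x : Fin n → ℝ≥0) : x ∈ Attr (circ a) := by
  have h0 : ∀ g, a g = 0 := fun g => le_zero_iff.1 (ha ▸ Finset.le_sup (Finset.mem_univ g))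
  rw [mem_Attr_iff, lam_circ, ha]
  refine ⟨0, funext fun i => ?_⟩
  simp [mvec_circ_apply, h0]

lemma IsIntervalFam.le_of_mem {S : Fin n → Set ℝ≥0} {lo hi : Fin n → ℝ≥0}
    (hS : IsIntervalFam S lo hi) {k : Fin n} {r : ℝ≥0} (hr : r ∈ S k) : lo k ≤ r ∧ r ≤ hi k := by
  rcases (hS k).2 with h | h | h | h <;> rw [h] at hr
  exacts [hr, ⟨hr.1, hr.2.le⟩, ⟨hr.1.le, hr.2⟩, ⟨hr.1.le, hr.2.le⟩]

lemma sup_min_eq {alo ahi : Fin n → ℝ≥0} (hle : ∀ k, alo k ≤ ahi k) :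
    (Finset.univ.sup fun k => min (Finset.univ.sup alo) (ahi k)) = Finset.univ.sup alo :=
  le_antisymm (Finset.sup_le fun _ _ => min_le_left _ _) <|
    Finset.sup_mono_fun fun k hk => le_min (Finset.le_sup hk) (hle k)

lemma Attr_circ_subset_Attr_Ahat [NeZero n] {Sa : Fin n → Set ℝ≥0} {alo ahi : Fin n → ℝ≥0}
    (hSa : IsIntervalFam Sa alo ahi) (hle : ∀ k, alo k ≤ ahi k) {a : Fin n → ℝ≥0}
    (ha : ∀ k, a k ∈ Sa k) : Attr (circ a) ⊆ Attr (Ahat alo ahi) := by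
  have hhat := sup_min_eq hle
  by_cases h0 : Finset.univ.sup alo = 0
  · exact fun x _ => mem_Attr_circ_of_sup_eq_zero (hhat.trans h0) x
  have hlo : Finset.univ.sup alo ≤ Finset.univ.sup a :=
    Finset.sup_mono_fun fun k _ => (hSa.le_of_mem (ha k)).1
  have ha0 : Finset.univ.sup a ≠ 0 := fun h => h0 (le_zero_iff.1 (h ▸ hlo))
  refine Attr_circ_subset ha0 (by rwa [hhat]) fun k => ?_
  have hk : a k ≤ Finset.univ.sup a := Finset.le_sup (Finset.mem_univ k)
  rw [hhat]
  simp only [Pi.smul_apply, smul_eq_mul]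
  rcases min_cases (Finset.univ.sup alo) (ahi k) with ⟨h, -⟩ | ⟨h, -⟩ <;> rw [h]
  · rw [inv_mul_cancel₀ h0, ← inv_mul_cancel₀ ha0]
    gcongr
  · have hpos := pos_iff_ne_zero.2 h0
    have := (hSa.le_of_mem (ha k)).2
    gcongr

end MaxAlg

open MaxAlg in
/-- `𝐗` is tolerance `C(𝐚)`-robust iff `C(𝐚)` is possibly `𝐗`-robust
(for `C(𝐚)` containing `Â`). -/
theorem tolerance_C_robust_iff_possibly_X_robust
    (n : ℕ) (hn : 1 ≤ n)
    (S : Fin n → Set ℝ≥0) (lo hi : Fin n → ℝ≥0) (hS : IsIntervalFam S lo hi)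
    (Sa : Fin n → Set ℝ≥0) (alo ahi : Fin n → ℝ≥0) (hSa : IsIntervalFam Sa alo ahi)
    (hle : ∀ k, alo k ≤ ahi k)
    (hhat : Ahat alo ahi ∈ Cset Sa) :
    (∀ x ∈ box S, ∃ A ∈ Cset Sa, x ∈ Attr A) ↔
      (∃ A ∈ Cset Sa, ∀ x ∈ box S, x ∈ Attr A) := by 
  have : NeZero n := ⟨Nat.one_le_iff_ne_zero.1 hn⟩
  refine ⟨fun h => ⟨_, hhat, fun x hx => ?_⟩, fun ⟨A, hA, h⟩ x hx => ⟨A, hA, h x hx⟩⟩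
  obtain ⟨_, ⟨a, ha, rfl⟩, hxA⟩ := h x hx
  exact Attr_circ_subset_Attr_Ahat hSa hle ha hxA
end

section
/- Let n ≥ 1 and let A ∈ ℝ≥0^{n×n} be a nonzero circulant matrix. Then for all i, j ∈ {1,…,n}, the pair (i,j) is a critical edge of A if and only if A_{ij} = λ(A). (In particular A is strictly visualized: all entries satisfy A_{ij} ≤ λ(A), with equality exactly on the critical edges, so crit(A) coincides with the threshold digraph of A with respect to λ(A).) -/
open scoped NNReal Classical

namespace MaxAlg

lemma cycMean_of_forall_eq {n k : ℕ} (hk : k ≠ 0) {A : Matrix (Fin n) (Fin n) ℝ≥0}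
    {c : Fin k → Fin n} {r : ℝ≥0} (h : ∀ l, A (c l) (c (cyc l)) = r) :
    cycMean A k c = r := by
  simp only [cycMean, h, Finset.prod_const, Finset.card_univ, Fintype.card_fin, one_div]
  exact NNReal.pow_rpow_inv_natCast r hk

lemma cycMean_le_lam {n k : ℕ} (A : Matrix (Fin n) (Fin n) ℝ≥0) (hk : k ∈ Finset.Icc 1 n)
    (c : Fin k → Fin n) : cycMean A k c ≤ lam A :=
  (Finset.le_sup (f := cycMean A k) (Finset.mem_univ c)).trans
    (Finset.le_sup (f := fun k => Finset.univ.sup fun c : Fin k → Fin n => cycMean A k c) hk)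

/-- The closed walk `i, i + t, i + 2t, …` with `t = j - i`, of length `n`. -/
def stepCycle {n : ℕ} [NeZero n] (i j : Fin n) (l : Fin n) : Fin n := i + l.val • (j - i)

lemma stepCycle_zero {n : ℕ} [NeZero n] (i j : Fin n) : stepCycle i j 0 = i := by
  simp [stepCycle]

lemma stepCycle_cyc {n : ℕ} [NeZero n] (i j l : Fin n) :
    stepCycle i j (cyc l) = stepCycle i j l + (j - i) := by
  have h := mod_card_nsmul (j - i) (l.val + 1)
  rw [Fintype.card_fin] at h
  simp only [stepCycle, cyc, h, succ_nsmul, add_assoc]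

lemma circ_stepCycle {n : ℕ} [NeZero n] (a : Fin n → ℝ≥0) (i j l : Fin n) :
    circ a (stepCycle i j l) (stepCycle i j (cyc l)) = circ a i j := by
  rw [stepCycle_cyc, circ, circ, add_sub_cancel_left]

lemma cycMean_stepCycle {n : ℕ} [NeZero n] (a : Fin n → ℝ≥0) (i j : Fin n) :
    cycMean (circ a) n (stepCycle i j) = circ a i j :=
  cycMean_of_forall_eq (NeZero.ne n) (circ_stepCycle a i j)

lemma circ_le_lam {n : ℕ} [NeZero n] (a : Fin n → ℝ≥0) (i j : Fin n) :
    circ a i j ≤ lam (circ a) :=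
  (cycMean_stepCycle a i j).symm.trans_le
    (cycMean_le_lam _ (Finset.mem_Icc.2 ⟨NeZero.one_le, le_rfl⟩) _)

/-- If all entries are at most `λ(A)`, then every critical edge attains `λ(A)`. -/
lemma IsCritEdge.eq_lam {n : ℕ} {A : Matrix (Fin n) (Fin n) ℝ≥0} (hle : ∀ i j, A i j ≤ lam A)
    {i j : Fin n} (h : IsCritEdge A i j) : A i j = lam A := by
  obtain ⟨-, k, c, hk, hpos, hmean, l, rfl, rfl⟩ := h
  by_contra hne
  have hlt : ∏ l : Fin k, A (c l) (c (cyc l)) < ∏ _l : Fin k, lam A :=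
    Finset.prod_lt_prod (fun l _ => pos_iff_ne_zero.2 (hpos l)) (fun l _ => hle _ _)
      ⟨l, Finset.mem_univ l, lt_of_le_of_ne (hle _ _) hne⟩
  refine hlt.ne ?_
  rw [Finset.prod_const, Finset.card_univ, Fintype.card_fin, ← hmean, cycMean, one_div,
    NNReal.rpow_inv_natCast_pow _ (Nat.one_le_iff_ne_zero.1 hk)]

end MaxAlg

open MaxAlg in
/-- a nonzero circulant matrix is strictly visualized: all entries are at most
`λ(A)`, and `(i,j)` is a critical edge iff `A_{ij} = λ(A)`. -/
theorem circulant_strictly_visualized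
    (n : ℕ) (hn : 1 ≤ n) (A : Matrix (Fin n) (Fin n) ℝ≥0)
    (hA : IsCirculant A) (hA0 : A ≠ 0) :
    (∀ i j : Fin n, A i j ≤ lam A) ∧
    (∀ i j : Fin n, IsCritEdge A i j ↔ A i j = lam A) := by
  have : NeZero n := ⟨Nat.one_le_iff_ne_zero.1 hn⟩
  obtain ⟨a, rfl⟩ := hA
  have hle := circ_le_lam a
  refine ⟨hle, fun i j => ⟨IsCritEdge.eq_lam hle, fun h => ?_⟩⟩
  have hij : circ a i j ≠ 0 := by
    intro h0
    refine hA0 (Matrix.ext fun p q => ?_)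
    exact le_antisymm ((hle p q).trans_eq (h.symm.trans h0)) zero_le
  refine ⟨hij, n, stepCycle i j, hn, fun l => ?_, (cycMean_stepCycle a i j).trans h, 0,
    stepCycle_zero i j, ?_⟩
  · rwa [circ_stepCycle]
  · rw [stepCycle_cyc, stepCycle_zero, add_sub_cancel]
end

section
/- Let n ≥ 1, let A ∈ ℝ≥0^{n×n} be a nonzero circulant matrix, and set B = (A/λ(A))^{n²}, the n²-th max-algebraic power of the matrix A/λ(A) (entrywise division by λ(A), which is nonzero). Then B is a Kleene star: B⊗B = B and B_{ii} = 1 for all i ∈ {1,…,n} (equivalently, B_{ii} = 1 for all i and B_{ij}·B_{jk} ≤ B_{ik} for all i, j, k). -/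
open scoped NNReal Classical

open Finset in
/-- The max-algebraic power of a circulant dominates the weight of every multiset of steps. -/
theorem prod_pow_le_mpow_circ {n : ℕ} [NeZero n] (b : Fin n → ℝ≥0) (m : ℕ) :
    ∀ (f : Fin n → ℕ) (i j : Fin n), ∑ t, f t = m → ∑ t, f t • t = j - i →
      ∏ t, b t ^ f t ≤ MaxAlg.mpow (MaxAlg.circ b) m i j := by
  induction m with
  | zero =>
    intro f i j hf hs
    have h0 : ∀ t, f t = 0 := by simpa using hf
    have hij : i = j := by
      simp only [h0, zero_smul, sum_const_zero] at hs
      exact (sub_eq_zero.mp hs.symm).symm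
    simp [h0, MaxAlg.mpow, MaxAlg.mId, hij]
  | succ m ih =>
    intro f i j hf hs
    obtain ⟨t, -, ht⟩ : ∃ t ∈ univ, f t ≠ 0 := exists_ne_zero_of_sum_ne_zero (by omega)
    obtain ⟨g, hg⟩ : ∃ g : Fin n → ℕ, ∀ s, f s = g s + if s = t then 1 else 0 := by
      refine ⟨fun s => f s - if s = t then 1 else 0, fun s => ?_⟩
      by_cases h : s = t
      · subst h
        simp only [if_true]
        omega
      · simp [h]
    have hgm : ∑ s, g s = m := by
      simpa [hg, sum_add_distrib] using hf
    have hgs : ∑ s, g s • s + t = j - i := by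
      simpa [hg, sum_add_distrib, add_smul] using hs
    have hprod : ∏ s, b s ^ f s = (∏ s, b s ^ g s) * b t := by
      simp only [hg, pow_add, prod_mul_distrib, pow_ite, pow_one, pow_zero, prod_ite_eq', mem_univ,
        if_true]
    have hstep : MaxAlg.circ b (j - t) j = b t := by
      simp [MaxAlg.circ]
    rw [hprod, ← hstep]
    refine le_trans (mul_le_mul_left (ih g i (j - t) hgm ?_) _)
      (le_sup (f := fun k => MaxAlg.mpow (MaxAlg.circ b) m i k * MaxAlg.circ b k j)
        (mem_univ (j - t)))
    rw [eq_sub_of_add_eq hgs]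
    abel

open Finset in
/-- A nonzero entry of a max-algebraic power of a circulant is bounded by the weight
of some multiset of steps. -/
theorem exists_mpow_circ_le_prod_pow {n : ℕ} [NeZero n] (b : Fin n → ℝ≥0) (m : ℕ) :
    ∀ i j : Fin n, MaxAlg.mpow (MaxAlg.circ b) m i j ≠ 0 →
      ∃ f : Fin n → ℕ, ∑ t, f t = m ∧ ∑ t, f t • t = j - i ∧
        MaxAlg.mpow (MaxAlg.circ b) m i j ≤ ∏ t, b t ^ f t := by
  induction m with
  | zero =>
    intro i j h
    have hij : i = j := by
      by_contra hne
      simp [MaxAlg.mpow, MaxAlg.mId, hne] at h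
    exact ⟨0, by simp, by simp [hij], by simp [MaxAlg.mpow, MaxAlg.mId, hij]⟩
  | succ m ih =>
    intro i j h
    obtain ⟨k, -, hk⟩ := exists_mem_eq_sup univ univ_nonempty
      (fun k => MaxAlg.mpow (MaxAlg.circ b) m i k * MaxAlg.circ b k j)
    change MaxAlg.mpow (MaxAlg.circ b) (m + 1) i j = _ at hk
    rw [hk] at h ⊢
    obtain ⟨f, hf, hs, hle⟩ := ih i k (left_ne_zero_of_mul h)
    refine ⟨fun s => f s + if s = j - k then 1 else 0, ?_, ?_, ?_⟩
    · simp [sum_add_distrib, hf]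
    · simp [sum_add_distrib, add_smul, hs]
    · simp only [pow_add, prod_mul_distrib, pow_ite, pow_one, pow_zero, prod_ite_eq', mem_univ,
        if_true]
      exact mul_le_mul_left hle _

/-- The order of `Fin n` annihilates every element. -/
theorem fin_nsmul_eq_zero {n : ℕ} [NeZero n] (t : Fin n) : n • t = 0 := by
  simpa using card_nsmul_eq_zero (x := t)

theorem fin_mod_nsmul {n : ℕ} [NeZero n] (k : ℕ) (t : Fin n) : (k % n) • t = k • t := by
  conv_rhs => rw [← Nat.mod_add_div k n, add_smul, mul_comm, mul_smul, fin_nsmul_eq_zero,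
    smul_zero, add_zero]

open Finset in
/-- A multiset of `2n²` steps can be shortened to `n²` steps with the same total and
no smaller weight, when the weights are at most `1` and some step has weight `1`. -/
theorem exists_shorter_steps {n : ℕ} [NeZero n] (b : Fin n → ℝ≥0) (hb : ∀ t, b t ≤ 1)
    (u : Fin n) (hu : b u = 1) (f : Fin n → ℕ) (hf : ∑ t, f t = n ^ 2 + n ^ 2) :
    ∃ g : Fin n → ℕ, ∑ t, g t = n ^ 2 ∧ ∑ t, g t • t = ∑ t, f t • t ∧
      ∏ t, b t ^ f t ≤ ∏ t, b t ^ g t := by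
  have hn : 0 < n := NeZero.pos n
  have hle : ∑ t ∈ univ.erase u, f t % n ≤ n ^ 2 := by
    calc ∑ t ∈ univ.erase u, f t % n ≤ ∑ t, f t % n :=
          sum_le_sum_of_subset (erase_subset _ _)
      _ ≤ ∑ _t : Fin n, n := sum_le_sum fun t _ => (Nat.mod_lt _ hn).le
      _ = n ^ 2 := by simp [sq]
  set r := ∑ t ∈ univ.erase u, f t % n with hr
  have hq : ∑ t ∈ univ.erase u, f t = r + n * ∑ t ∈ univ.erase u, f t / n := by
    rw [hr, mul_sum, ← sum_add_distrib]
    exact sum_congr rfl fun t _ => (Nat.mod_add_div _ _).symm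
  set q := ∑ t ∈ univ.erase u, f t / n
  have hfu : f u + (r + n * q) = n ^ 2 + n ^ 2 := by
    rw [← hq, add_sum_erase _ _ (mem_univ u), hf]
  have hcong : n ^ 2 - r + n ^ 2 = f u + n * q := by omega
  have hgu : (n ^ 2 - r) • u = f u • u := by
    have h := congrArg (fun k : ℕ => k • u) hcong
    simpa [add_smul, sq, mul_comm n q, mul_smul, fin_nsmul_eq_zero] using h
  have hne : ∀ t ∈ univ.erase u, t ≠ u := fun t ht => ne_of_mem_erase ht
  refine ⟨fun t => if t = u then n ^ 2 - r else f t % n, ?_, ?_, ?_⟩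
  · rw [← add_sum_erase _ _ (mem_univ u), sum_congr rfl fun t ht => if_neg (hne t ht), if_pos rfl]
    omega
  · refine sum_congr rfl fun t _ => ?_
    by_cases h : t = u
    · simpa [h] using hgu
    · simp only [h, if_false, fin_mod_nsmul]
  · refine prod_le_prod' fun t _ => ?_
    by_cases h : t = u
    · simp [h, hu]
    · simp only [h, if_false]
      exact pow_le_pow_of_le_one zero_le (hb t) (Nat.mod_le _ _)

open Finset in
/-- A circulant matrix with largest entry `1` has a Kleene star as its `n²`-th power. -/
theorem mpow_circ_kleene_star {n : ℕ} [NeZero n] (b : Fin n → ℝ≥0) (hb : ∀ t, b t ≤ 1)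
    (u : Fin n) (hu : b u = 1) :
    MaxAlg.mmul (MaxAlg.mpow (MaxAlg.circ b) (n ^ 2)) (MaxAlg.mpow (MaxAlg.circ b) (n ^ 2)) =
        MaxAlg.mpow (MaxAlg.circ b) (n ^ 2) ∧
      ∀ i : Fin n, MaxAlg.mpow (MaxAlg.circ b) (n ^ 2) i i = 1 := by
  have hdiag : ∀ i : Fin n, MaxAlg.mpow (MaxAlg.circ b) (n ^ 2) i i = 1 := by
    intro i
    apply le_antisymm
    · by_cases h : MaxAlg.mpow (MaxAlg.circ b) (n ^ 2) i i = 0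
      · simp [h]
      · obtain ⟨f, -, -, hle⟩ := exists_mpow_circ_le_prod_pow b _ i i h
        exact hle.trans (prod_le_one' fun t _ => pow_le_one' (hb t) _)
    · have h := prod_pow_le_mpow_circ b (n ^ 2) (fun t => if t = u then n ^ 2 else 0) i i
        (by simp) (by simp [sq, mul_smul, fin_nsmul_eq_zero])
      simpa [pow_ite, hu] using h
  refine ⟨?_, hdiag⟩
  funext i k
  apply le_antisymm
  · refine Finset.sup_le fun j _ => ?_
    by_cases h : MaxAlg.mpow (MaxAlg.circ b) (n ^ 2) i j *
        MaxAlg.mpow (MaxAlg.circ b) (n ^ 2) j k = 0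
    · simp [h]
    obtain ⟨f, hf, hfs, hfle⟩ := exists_mpow_circ_le_prod_pow b _ i j (left_ne_zero_of_mul h)
    obtain ⟨f', hf', hfs', hfle'⟩ := exists_mpow_circ_le_prod_pow b _ j k (right_ne_zero_of_mul h)
    obtain ⟨g, hg, hgs, hgle⟩ := exists_shorter_steps b hb u hu (fun t => f t + f' t)
      (by rw [sum_add_distrib, hf, hf'])
    refine (mul_le_mul' hfle hfle').trans ?_
    rw [← prod_mul_distrib]
    simp only [← pow_add]
    refine hgle.trans (prod_pow_le_mpow_circ b _ g i k hg ?_)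
    simp only [hgs, add_smul, sum_add_distrib, hfs, hfs']
    abel
  · have h := le_sup (f := fun j => MaxAlg.mpow (MaxAlg.circ b) (n ^ 2) i j *
      MaxAlg.mpow (MaxAlg.circ b) (n ^ 2) j k) (mem_univ i)
    simp only [hdiag, one_mul] at h
    exact h

open Finset in
/-- Every entry of a circulant is at most its maximum cycle mean. -/
theorem le_lam_circ {n : ℕ} [NeZero n] (a : Fin n → ℝ≥0) (t : Fin n) :
    a t ≤ MaxAlg.lam (MaxAlg.circ a) := by
  have hn : n ≠ 0 := NeZero.ne n
  have hc : MaxAlg.cycMean (MaxAlg.circ a) n (fun l => (l : ℕ) • t) = a t := by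
    have hstep : ∀ l : Fin n,
        MaxAlg.circ a ((l : ℕ) • t) ((MaxAlg.cyc l : ℕ) • t) = a t := by
      intro l
      simp [MaxAlg.circ, MaxAlg.cyc, fin_mod_nsmul, add_smul]
    unfold MaxAlg.cycMean
    rw [prod_congr rfl fun l _ => hstep l, prod_const, card_univ, Fintype.card_fin, one_div,
      NNReal.pow_rpow_inv_natCast _ hn]
  calc a t = MaxAlg.cycMean (MaxAlg.circ a) n (fun l => (l : ℕ) • t) := hc.symm
    _ ≤ univ.sup fun c : Fin n → Fin n => MaxAlg.cycMean (MaxAlg.circ a) n c :=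
      le_sup (f := fun c => MaxAlg.cycMean (MaxAlg.circ a) n c) (mem_univ _)
    _ ≤ MaxAlg.lam (MaxAlg.circ a) :=
      le_sup (f := fun k => univ.sup fun c : Fin k → Fin n => MaxAlg.cycMean (MaxAlg.circ a) k c)
        (mem_Icc.mpr ⟨NeZero.one_le, le_rfl⟩)

open Finset in
/-- The maximum cycle mean is at most any bound on the entries. -/
theorem lam_le_of_forall_le {n : ℕ} (A : Matrix (Fin n) (Fin n) ℝ≥0) (M : ℝ≥0)
    (hM : ∀ i j, A i j ≤ M) : MaxAlg.lam A ≤ M := by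
  refine Finset.sup_le fun k hk => Finset.sup_le fun c _ => ?_
  have hk0 : k ≠ 0 := by
    have := (mem_Icc.mp hk).1
    omega
  calc MaxAlg.cycMean A k c ≤ (M ^ k) ^ ((1 : ℝ) / (k : ℝ)) := by
        refine NNReal.rpow_le_rpow ?_ (by positivity)
        simpa using prod_le_prod' (s := univ) fun (l : Fin k) _ => hM (c l) (c (MaxAlg.cyc l))
    _ = M := by rw [one_div, NNReal.pow_rpow_inv_natCast _ hk0]

open MaxAlg in
/-- for a nonzero circulant `A`, the matrix `B = (A/λ(A))^{n²}` is a Kleene star: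
`B⊗B = B` and `B_{ii} = 1` for all `i`. -/
theorem circulant_power_kleene_star
    (n : ℕ) (hn : 1 ≤ n) (A : Matrix (Fin n) (Fin n) ℝ≥0)
    (hA : IsCirculant A) (hA0 : A ≠ 0) :
    mmul (mpow (fun i j => A i j / lam A) (n ^ 2)) (mpow (fun i j => A i j / lam A) (n ^ 2)) =
        mpow (fun i j => A i j / lam A) (n ^ 2) ∧
      ∀ i : Fin n, mpow (fun i j => A i j / lam A) (n ^ 2) i i = 1 := by
  have : NeZero n := ⟨by omega⟩
  obtain ⟨a, rfl⟩ := hA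
  obtain ⟨u, -, hu⟩ := Finset.exists_max_image Finset.univ a Finset.univ_nonempty
  have hlam : lam (circ a) = a u :=
    le_antisymm (lam_le_of_forall_le _ _ fun i j => hu (j - i) (Finset.mem_univ _))
      (le_lam_circ a u)
  have hu0 : a u ≠ 0 := by
    intro h
    apply hA0
    ext i j
    have := hu (j - i) (Finset.mem_univ _)
    rw [h] at this
    simpa [circ] using this
  have h := mpow_circ_kleene_star (fun t => a t / lam (circ a))
    (fun t => by rw [hlam]; exact div_le_one_of_le₀ (hu t (Finset.mem_univ _)) zero_le)
    u (by simp only [hlam]; exact div_self hu0)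
  exact h
end
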